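/- arXiv:1907.11288 — 2 statements merged into one kernel-verified Lean document; each statement's English description precedes it below -/
import Mathlib

section
/- Let R be an infinite commutative domain and F = R⟨x, y⟩/(x², y²). For every n ≥ 1, the algebra F satisfies the standard polynomial identity S_{2n} (i.e. S_{2n}(u_1,…,u_{2n}) = 0 for all u_1,…,u_{2n} ∈ F) if and only if n ≥ 2. -/
open scoped BigOperators

/-- The relation on the free associative unital `R`-algebra on two generators `x, y`
identifying `x²` and `y²` with `0`; the corresponding `RingQuot` is the quotient
`F = R⟨x, y⟩/(x², y²)` by the two-sided ideal generated by `x²` and `y²`. -/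
def sqRel (R : Type*) [CommRing R] :
    FreeAlgebra R (Fin 2) → FreeAlgebra R (Fin 2) → Prop := fun a b =>
  (a = FreeAlgebra.ι R (0 : Fin 2) ^ 2 ∧ b = 0) ∨
  (a = FreeAlgebra.ι R (1 : Fin 2) ^ 2 ∧ b = 0)

/-- The standard polynomial of degree `k`, evaluated at `x₁, …, x_k`:
`S_k(x₁,…,x_k) = ∑_{σ ∈ Sym(k)} sgn(σ) · x_{σ(1)} ⋯ x_{σ(k)}`. -/
noncomputable def stdPoly {A : Type*} [Ring A] (k : ℕ) (x : Fin k → A) : A :=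
  ∑ σ : Equiv.Perm (Fin k), (Equiv.Perm.sign σ : ℤ) • (List.ofFn fun i => x (σ i)).prod

theorem stdPoly_succ {A : Type*} [Ring A] (k : ℕ) (x : Fin (k + 1) → A) :
    stdPoly (k + 1) x = ∑ p : Fin (k + 1), (if p = 0 then (1 : ℤ) else -1) •
      (x p * stdPoly k fun i => x (Equiv.swap 0 p i.succ)) := by
  rw [stdPoly, ← Equiv.Perm.decomposeFin.symm.sum_comp, Fintype.sum_prod_type]
  refine Finset.sum_congr rfl fun p _ => ?_
  rw [stdPoly, Finset.mul_sum, Finset.smul_sum]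
  refine Finset.sum_congr rfl fun e _ => ?_
  rw [Equiv.Perm.decomposeFin.symm_sign, List.ofFn_succ, List.prod_cons]
  simp only [Equiv.Perm.decomposeFin_symm_apply_zero, Equiv.Perm.decomposeFin_symm_apply_succ]
  split_ifs <;> simp [-zsmul_eq_mul]

theorem stdPoly_eq_zero_of_le {A : Type*} [Ring A] {k m : ℕ} (hkm : k ≤ m)
    (hk : ∀ x : Fin k → A, stdPoly k x = 0) (x : Fin m → A) : stdPoly m x = 0 := by
  induction m, hkm using Nat.le_induction with
  | base => exact hk x
  | succ m _ ih => simp [stdPoly_succ, ih]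

theorem map_stdPoly {A B : Type*} [Ring A] [Ring B] (f : A →+* B) (k : ℕ) (x : Fin k → A) :
    f (stdPoly k x) = stdPoly k fun i => f (x i) := by
  simp [stdPoly, map_sum, map_list_prod, List.map_ofFn, Function.comp_def]

theorem stdPoly_two {A : Type*} [Ring A] (x : Fin 2 → A) :
    stdPoly 2 x = x 0 * x 1 - x 1 * x 0 := by
  refine (stdPoly_succ 1 x).trans ((Fin.sum_univ_two _).trans ?_)
  simp [stdPoly, sub_eq_add_neg]

theorem stdPoly_three {A : Type*} [Ring A] (x : Fin 3 → A) :
    stdPoly 3 x = x 0 * ⁅x 1, x 2⁆ - x 1 * ⁅x 0, x 2⁆ - x 2 * ⁅x 1, x 0⁆ := by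
  have h12 : Equiv.swap (0 : Fin 3) 1 2 = 2 := by decide
  have h21 : Equiv.swap (0 : Fin 3) 2 1 = 1 := by decide
  refine (stdPoly_succ 2 x).trans ((Fin.sum_univ_three _).trans ?_)
  simp [stdPoly_two, h12, h21, Ring.lie_def, sub_eq_add_neg]

theorem stdPoly_four {A : Type*} [Ring A] (x : Fin 4 → A) :
    stdPoly 4 x =
      ⁅x 0, x 1⁆ * ⁅x 2, x 3⁆ + ⁅x 2, x 3⁆ * ⁅x 0, x 1⁆
      - ⁅x 0, x 2⁆ * ⁅x 1, x 3⁆ - ⁅x 1, x 3⁆ * ⁅x 0, x 2⁆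
      + ⁅x 0, x 3⁆ * ⁅x 1, x 2⁆ + ⁅x 1, x 2⁆ * ⁅x 0, x 3⁆ := by
  have h12 : Equiv.swap (0 : Fin 4) 1 2 = 2 := by decide
  have h13 : Equiv.swap (0 : Fin 4) 1 3 = 3 := by decide
  have h21 : Equiv.swap (0 : Fin 4) 2 1 = 1 := by decide
  have h23 : Equiv.swap (0 : Fin 4) 2 3 = 3 := by decide
  have h31 : Equiv.swap (0 : Fin 4) 3 1 = 1 := by decide
  have h32 : Equiv.swap (0 : Fin 4) 3 2 = 2 := by decide
  refine (stdPoly_succ 3 x).trans ((Fin.sum_univ_four _).trans ?_)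
  simp [stdPoly_three, h12, h13, h21, h23, h31, h32, Ring.lie_def]
  noncomm_ring

/-- The case of `2 × 2` matrices in the Amitsur–Levitzki theorem. -/
theorem stdPoly_four_matrix_eq_zero {S : Type*} [CommRing S]
    (x : Fin 4 → Matrix (Fin 2) (Fin 2) S) : stdPoly 4 x = 0 := by
  rw [stdPoly_four]
  ext i j
  fin_cases i <;> fin_cases j <;>
    simp [Ring.lie_def, Matrix.mul_apply, Fin.sum_univ_two] <;> ring

section SquareZero

open Polynomial

variable {R : Type*} [CommRing R]

theorem mul_aeval_mul_comm {A : Type*} [Ring A] [Algebra R A] (a b : A) (p : R[X]) :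
    a * aeval (b * a) p = aeval (a * b) p * a := by
  induction p using Polynomial.induction_on' with
  | add p q hp hq => simp [mul_add, add_mul, hp, hq]
  | monomial n r =>
    have h : SemiconjBy a ((b * a) ^ n) ((a * b) ^ n) :=
      SemiconjBy.pow_right (by simp [SemiconjBy, mul_assoc]) n
    rw [aeval_monomial, aeval_monomial, ← Algebra.smul_def, ← Algebra.smul_def, mul_smul_comm,
      h.eq, smul_mul_assoc]

theorem mul_aeval_of_mul_eq_zero {A : Type*} [Ring A] [Algebra R A] {a c : A} (h : a * c = 0)
    (p : R[X]) : a * aeval c p = p.coeff 0 • a := by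
  conv_lhs => rw [← X_mul_divX_add p, map_add, map_mul, aeval_X, aeval_C, mul_add, ← mul_assoc, h]
  rw [zero_mul, zero_add, Algebra.smul_def, Algebra.commutes]

/-- The two square-zero generators of `R⟨x, y⟩/(x², y²)`. -/
def sqGen (R : Type*) [CommRing R] (i : Fin 2) : RingQuot (sqRel R) :=
  RingQuot.mkAlgHom R (sqRel R) (FreeAlgebra.ι R i)

theorem sqGen_mul_self (i : Fin 2) : sqGen R i * sqGen R i = 0 := by
  rw [← pow_two, sqGen, ← map_pow, ← map_zero (RingQuot.mkAlgHom R (sqRel R))]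
  refine RingQuot.mkAlgHom_rel R ?_
  fin_cases i <;> simp [sqRel]

/-- The representation of `R⟨x, y⟩/(x², y²)` sending `x` to `E₁₂` and `y` to `X • E₂₁`. -/
noncomputable def sqRep (R : Type*) [CommRing R] :
    RingQuot (sqRel R) →ₐ[R] Matrix (Fin 2) (Fin 2) R[X] :=
  RingQuot.liftAlgHom R ⟨FreeAlgebra.lift R ![!![0, 1; 0, 0], !![0, 0; X, 0]], by
    rintro a b (⟨rfl, rfl⟩ | ⟨rfl, rfl⟩) <;>
      ext i j <;> fin_cases i <;> fin_cases j <;> simp [pow_two]⟩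

theorem sqRep_zero : sqRep R (sqGen R 0) = !![0, 1; 0, 0] := by
  simp [sqRep, sqGen]

theorem sqRep_one : sqRep R (sqGen R 1) = !![0, 0; X, 0] := by
  simp [sqRep, sqGen]

/-- A map which is a left inverse of `sqRep R`. -/
noncomputable def sqRepInv (M : Matrix (Fin 2) (Fin 2) R[X]) : RingQuot (sqRel R) :=
  aeval (sqGen R 0 * sqGen R 1) (M 0 0) + aeval (sqGen R 1 * sqGen R 0) (M 1 1)
    - (M 1 1).coeff 0 • (1 : RingQuot (sqRel R))
    + aeval (sqGen R 0 * sqGen R 1) (M 0 1) * sqGen R 0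
    + sqGen R 1 * aeval (sqGen R 0 * sqGen R 1) (M 1 0).divX

theorem sqRepInv_add (M N : Matrix (Fin 2) (Fin 2) R[X]) :
    sqRepInv (M + N) = sqRepInv M + sqRepInv N := by
  simp only [sqRepInv, Matrix.add_apply, map_add, coeff_add, divX_add, add_smul, add_mul, mul_add]
  abel

theorem sqRepInv_smul (r : R) (M : Matrix (Fin 2) (Fin 2) R[X]) :
    sqRepInv (r • M) = r • sqRepInv M := by
  have h : ∀ p : R[X], (r • p).divX = r • p.divX := fun p => by ext; simp
  simp only [sqRepInv, Matrix.smul_apply, map_smul, coeff_smul, h, smul_add, smul_sub,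
    smul_mul_assoc, mul_smul_comm, smul_eq_mul, mul_smul]

theorem sqRepInv_sqRep_zero_mul {M : Matrix (Fin 2) (Fin 2) R[X]}
    (hd : (M 0 0).coeff 0 = (M 1 1).coeff 0) (hc : (M 1 0).coeff 0 = 0) :
    sqRepInv (sqRep R (sqGen R 0) * M) = sqGen R 0 * sqRepInv M := by
  have hxy : sqGen R 0 * (sqGen R 0 * sqGen R 1) = 0 := by
    rw [← mul_assoc, sqGen_mul_self, zero_mul]
  have h10 : aeval (sqGen R 0 * sqGen R 1) (M 1 0) =
      aeval (sqGen R 0 * sqGen R 1) (M 1 0).divX * (sqGen R 0 * sqGen R 1) := by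
    conv_lhs => rw [← divX_mul_X_add (M 1 0), hc]
    simp
  simp only [sqRepInv, mul_add, mul_sub, ← mul_assoc, mul_aeval_mul_comm,
    mul_aeval_of_mul_eq_zero hxy, sqRep_zero, smul_mul_assoc, sqGen_mul_self, mul_smul_comm]
  simp [hd, h10, Matrix.mul_apply, Fin.sum_univ_two, mul_assoc]
  abel

theorem sqRepInv_sqRep_one_mul (M : Matrix (Fin 2) (Fin 2) R[X]) :
    sqRepInv (sqRep R (sqGen R 1) * M) = sqGen R 1 * sqRepInv M := by
  have hyx : sqGen R 1 * (sqGen R 1 * sqGen R 0) = 0 := by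
    rw [← mul_assoc, sqGen_mul_self, zero_mul]
  have h01 : sqGen R 1 * aeval (sqGen R 0 * sqGen R 1) (M 0 1) * sqGen R 0 =
      sqGen R 1 * sqGen R 0 * aeval (sqGen R 1 * sqGen R 0) (M 0 1) := by
    rw [mul_assoc, ← mul_aeval_mul_comm, mul_assoc]
  have h00 : (X * M 0 0).divX = M 0 0 := by ext; simp
  simp only [sqRepInv, mul_add, mul_sub, ← mul_assoc, h01,
    mul_aeval_of_mul_eq_zero hyx, sqRep_one, sqGen_mul_self, mul_smul_comm]
  simp [h00, Matrix.mul_apply, Fin.sum_univ_two, mul_assoc]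
  abel

theorem sqRepInv_mkAlgHom_mul (w : FreeAlgebra R (Fin 2)) {M : Matrix (Fin 2) (Fin 2) R[X]}
    (hd : (M 0 0).coeff 0 = (M 1 1).coeff 0) (hc : (M 1 0).coeff 0 = 0) :
    let z := RingQuot.mkAlgHom R (sqRel R) w
    ((sqRep R z * M) 0 0).coeff 0 = ((sqRep R z * M) 1 1).coeff 0 ∧
      ((sqRep R z * M) 1 0).coeff 0 = 0 ∧ sqRepInv (sqRep R z * M) = z * sqRepInv M := by
  induction w using FreeAlgebra.induction generalizing M with
  | grade0 r =>
    simp only [AlgHom.commutes, ← Algebra.smul_def, sqRepInv_smul]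
    simp [hd, hc]
  | grade1 i =>
    rw [← sqGen]
    obtain rfl | rfl : i = 0 ∨ i = 1 := by omega
    · refine ⟨?_, ?_, sqRepInv_sqRep_zero_mul hd hc⟩ <;>
        simp [sqRep_zero, Matrix.mul_apply, Fin.sum_univ_two, hc]
    · refine ⟨?_, ?_, sqRepInv_sqRep_one_mul M⟩ <;>
        simp [sqRep_one, Matrix.mul_apply, Fin.sum_univ_two]
  | mul a b ha hb =>
    obtain ⟨h1, h2, h3⟩ := hb hd hc
    obtain ⟨h4, h5, h6⟩ := ha h1 h2
    simp only [map_mul, mul_assoc]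
    exact ⟨h4, h5, by rw [h6, h3]⟩
  | add a b ha hb =>
    obtain ⟨h1, h2, h3⟩ := hb hd hc
    obtain ⟨h4, h5, h6⟩ := ha hd hc
    simp only [map_add, add_mul, Matrix.add_apply, coeff_add, sqRepInv_add, h1, h2, h3, h4, h5, h6]
    simp

theorem sqRep_injective : Function.Injective (sqRep R) := by
  refine Function.LeftInverse.injective (g := sqRepInv) fun z => ?_
  obtain ⟨w, rfl⟩ := RingQuot.mkAlgHom_surjective R (sqRel R) z
  have h := (sqRepInv_mkAlgHom_mul w (M := 1) (by simp) (by simp)).2.2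
  have h1 : sqRepInv (1 : Matrix (Fin 2) (Fin 2) R[X]) = 1 := by simp [sqRepInv]
  rwa [mul_one, h1, mul_one] at h

theorem stdPoly_two_sqGen_ne_zero [Nontrivial R] : stdPoly 2 (sqGen R) ≠ 0 := by
  intro h
  have h' := congrArg (fun z => sqRep R z 0 0) h
  simp [stdPoly_two, sqRep_zero, sqRep_one] at h'

end SquareZero

/-- Let `R` be an infinite commutative domain and `F = R⟨x, y⟩/(x², y²)`.  For every
`n ≥ 1`, `F` satisfies the standard polynomial identity `S_{2n}` if and only if
`n ≥ 2`. -/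
theorem quotient_satisfies_S2n_iff
    {R : Type*} [CommRing R] [IsDomain R] [Infinite R] (n : ℕ) (hn : 1 ≤ n) :
    (∀ u : Fin (2 * n) → RingQuot (sqRel R), stdPoly (2 * n) u = 0) ↔ 2 ≤ n := by
  refine ⟨fun h => ?_, fun h u => ?_⟩
  · by_contra hlt
    obtain rfl : n = 1 := by omega
    exact stdPoly_two_sqGen_ne_zero (h (sqGen R))
  · refine stdPoly_eq_zero_of_le (k := 4) (by omega) (fun x => ?_) u
    apply sqRep_injective
    rw [map_zero]
    exact (map_stdPoly (sqRep R).toRingHom 4 x).trans (stdPoly_four_matrix_eq_zero _)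
end

section
/- Let R be an infinite field and F = R⟨x, y⟩/(x², y²). Then the unit group U(F) does not satisfy any group identity: for every nontrivial reduced word w in a free group F_k, there exist units u_1,…,u_k ∈ U(F) such that w(u_1,…,u_k) ≠ 1. -/
open scoped BigOperators

open Polynomial in
theorem degree_lt_degree_mul_add {R : Type*} [Field R] {f q r : R[X]} (hf : 0 < f.degree)
    (hr : r.degree < q.degree) : q.degree < (f * q + r).degree := by
  have hq : q ≠ 0 := by
    rintro rfl
    simp at hr
  have hf0 : f ≠ 0 := by
    rintro rfl
    simp at hf
  have h : q.degree < (f * q).degree := by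
    rw [degree_mul]
    rw [degree_eq_natDegree hf0] at hf ⊢
    rw [degree_eq_natDegree hq]
    norm_cast at hf ⊢
    omega
  rwa [degree_add_eq_left_of_degree_lt (hr.trans h)]

open Polynomial in
theorem degree_X_pow_sub_X_pow_pos {R : Type*} [Field R] {m n : ℕ} (h : m ≠ n) :
    0 < (X ^ m - X ^ n : R[X]).degree := by
  rcases lt_or_gt_of_ne h with h | h
  · rw [degree_sub_eq_right_of_degree_lt (by simpa using h), degree_X_pow]
    exact_mod_cast (by omega : 0 < n)
  · rw [degree_sub_eq_left_of_degree_lt (by simpa using h), degree_X_pow]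
    exact_mod_cast (by omega : 0 < m)

/-- The unit `1 + n` attached to an element `n` of square zero. -/
def oneAddUnit {A : Type*} [Ring A] (n : A) (hn : n * n = 0) : Aˣ where
  val := 1 + n
  inv := 1 - n
  val_inv := by simp [add_mul, mul_sub, hn]
  inv_val := by simp [sub_mul, mul_add, hn]

theorem mul_pow_mul_self_mul {A : Type*} [Ring A] {a : A} (b : A) (ha : a * a = 0) (n : ℕ) :
    a * (b * a) ^ n * (a * (b * a) ^ n) = 0 := by
  have h : a * (b * a) ^ n = (a * b) ^ n * a :=
    (show SemiconjBy a (b * a) (a * b) from by simp [SemiconjBy, mul_assoc]).pow_right n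
  calc a * (b * a) ^ n * (a * (b * a) ^ n)
      = (a * b) ^ n * (a * a) * (b * a) ^ n := by nth_rewrite 1 [h]; simp only [mul_assoc]
    _ = 0 := by simp [ha]

namespace PingPong

open Polynomial

variable {R : Type*} [Field R] {ι : Type*}

/-- The region of the plane over `R[X]` into which the letter `l` moves vectors: vectors `(p, q)`
with `p` close to `f i * q` for the letter `i`, and with `q` close to `-f i * p` for its inverse. -/
def region (f : ι → R[X]) (l : ι × Bool) (v : R[X] × R[X]) : Prop :=
  cond l.2 ((v.1 - f l.1 * v.2).degree < v.2.degree) ((v.2 + f l.1 * v.1).degree < v.1.degree)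

/-- The action of a letter on the plane over `R[X]`: a lower transvection followed by an upper one,
or the inverse of this. -/
noncomputable def act (f : ι → R[X]) (l : ι × Bool) (v : R[X] × R[X]) : R[X] × R[X] :=
  cond l.2 (v.1 + f l.1 * (v.2 + f l.1 * v.1), v.2 + f l.1 * v.1)
    (v.1 - f l.1 * v.2, v.2 - f l.1 * (v.1 - f l.1 * v.2))

variable {f : ι → R[X]} (hf : ∀ i, 0 < (f i).degree)
  (hff : ∀ i j, i ≠ j → 0 < (f i - f j).degree)
include hf

theorem region_act_one (l : ι × Bool) : region f l (act f l (1, 1)) := by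
  have h1 : ∀ g : R[X], 0 < g.degree → (1 : R[X]).degree < (1 + g).degree := by
    intro g hg
    rw [degree_add_eq_right_of_degree_lt (by simpa using hg)]
    simpa using hg
  obtain ⟨i, _ | _⟩ := l
  · simpa [region, act, sub_eq_add_neg] using h1 (-f i) (by simpa using hf i)
  · simpa [region, act] using h1 (f i) (hf i)

theorem not_region_one (l : ι × Bool) : ¬ region f l (1, 1) := by
  obtain ⟨i, _ | _⟩ := l
  · have h := hf i
    simp only [region, cond_false, mul_one, not_lt]
    rw [degree_add_eq_right_of_degree_lt (by simpa using h)]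
    simpa using h.le
  · have h := hf i
    simp only [region, cond_true, mul_one, not_lt]
    rw [degree_sub_eq_right_of_degree_lt (by simpa using h)]
    simpa using h.le

include hff

theorem region_act {l m : ι × Bool} (hlm : l.1 = m.1 → l.2 = m.2) {v : R[X] × R[X]}
    (hv : region f m v) : region f l (act f l v) := by
  obtain ⟨p, q⟩ := v
  obtain ⟨i, _ | _⟩ := l <;> obtain ⟨j, _ | _⟩ := m <;>
    simp only [region, act, cond_true, cond_false, sub_add_cancel, add_sub_cancel_right] at hv ⊢
  · have h := degree_lt_degree_mul_add (f := -f j) (by simpa using hf j) hv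
    rw [show -f j * p + (q + f j * p) = q by ring] at h
    have h' := degree_lt_degree_mul_add (f := -f i) (by simpa using hf i) h
    rwa [show -f i * q + p = p - f i * q by ring] at h'
  · have hij : j ≠ i := by
      rintro rfl
      simp at hlm
    have h := degree_lt_degree_mul_add (hff j i hij) hv
    rwa [show (f j - f i) * q + (p - f j * q) = p - f i * q by ring] at h
  · have hij : i ≠ j := by
      rintro rfl
      simp at hlm
    have h := degree_lt_degree_mul_add (hff i j hij) hv
    rwa [show (f i - f j) * p + (q + f j * p) = q + f i * p by ring] at h
  · have h := degree_lt_degree_mul_add (hf j) hv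
    rw [show f j * q + (p - f j * q) = p by ring] at h
    have h' := degree_lt_degree_mul_add (hf i) h
    rwa [show f i * p + q = q + f i * p by ring] at h'

theorem region_foldr_act {l : ι × Bool} {L : List (ι × Bool)}
    (hL : FreeGroup.IsReduced (l :: L)) :
    region f l ((l :: L).foldr (act f) (1, 1)) := by
  induction L generalizing l with
  | nil => exact region_act_one hf l
  | cons m L ih =>
    rw [FreeGroup.isReduced_cons_cons] at hL
    exact region_act hf hff hL.1 (ih hL.2)

theorem foldr_act_ne {L : List (ι × Bool)} (hL : FreeGroup.IsReduced L) (hne : L ≠ []) :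
    L.foldr (act f) (1, 1) ≠ (1, 1) := by
  cases L with
  | nil => exact absurd rfl hne
  | cons l L =>
    intro h
    exact not_region_one hf l (h ▸ region_foldr_act hf hff hL)

end PingPong

namespace sqRel

open Polynomial

variable (R : Type*) [Field R]

/-- The class of the generator `x` (for `0`) or `y` (for `1`). -/
noncomputable def gen (i : Fin 2) : RingQuot (sqRel R) :=
  RingQuot.mkAlgHom R (sqRel R) (FreeAlgebra.ι R i)

theorem gen_mul_self (i : Fin 2) : gen R i * gen R i = 0 := by
  have h : sqRel R (FreeAlgebra.ι R i ^ 2) 0 := by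
    fin_cases i
    · exact Or.inl ⟨rfl, rfl⟩
    · exact Or.inr ⟨rfl, rfl⟩
  simpa [gen, sq] using RingQuot.mkAlgHom_rel R h

/-- The representation of `R⟨x, y⟩/(x², y²)` on the plane over `R[X]` in which `x` sends `(p, q)`
to `(q, 0)` and `y` sends it to `(0, X * p)`. -/
noncomputable def rep : RingQuot (sqRel R) →ₐ[R] Module.End R (R[X] × R[X]) :=
  RingQuot.liftAlgHom R ⟨FreeAlgebra.lift R
    ![LinearMap.inl R R[X] R[X] ∘ₗ LinearMap.snd R R[X] R[X],
      LinearMap.inr R R[X] R[X] ∘ₗ LinearMap.mulLeft R X ∘ₗ LinearMap.fst R R[X] R[X]], by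
    rintro _ _ (⟨rfl, rfl⟩ | ⟨rfl, rfl⟩) <;>
    · refine LinearMap.ext fun v => ?_
      simp [sq, Module.End.mul_apply]⟩

theorem rep_gen_zero (v : R[X] × R[X]) : rep R (gen R 0) v = (v.2, 0) := by
  simp [rep, gen]

theorem rep_gen_one (v : R[X] × R[X]) : rep R (gen R 1) v = (0, X * v.1) := by
  simp [rep, gen]

theorem rep_upper (n : ℕ) (v : R[X] × R[X]) :
    rep R (gen R 0 * (gen R 1 * gen R 0) ^ n) v = (X ^ n * v.2, 0) := by
  induction n generalizing v with
  | zero => simp [rep_gen_zero]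
  | succ n ih =>
    rw [pow_succ, ← mul_assoc, map_mul, Module.End.mul_apply, ih, map_mul, Module.End.mul_apply,
      rep_gen_zero, rep_gen_one, pow_succ, mul_assoc]

theorem rep_lower (n : ℕ) (v : R[X] × R[X]) :
    rep R (gen R 1 * (gen R 0 * gen R 1) ^ n) v = (0, X ^ (n + 1) * v.1) := by
  induction n generalizing v with
  | zero => simp [rep_gen_one]
  | succ n ih =>
    rw [pow_succ, ← mul_assoc, map_mul, Module.End.mul_apply, ih, map_mul, Module.End.mul_apply,
      rep_gen_one, rep_gen_zero, pow_succ X (n + 1), mul_assoc]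

/-- The units `(1 + x (y x)ⁿ⁺¹) (1 + y (x y)ⁿ)`, which freely generate a free group. -/
noncomputable def freeUnit (n : ℕ) : (RingQuot (sqRel R))ˣ :=
  oneAddUnit _ (mul_pow_mul_self_mul (gen R 1) (gen_mul_self R 0) (n + 1)) *
    oneAddUnit _ (mul_pow_mul_self_mul (gen R 0) (gen_mul_self R 1) n)

theorem rep_freeUnit {k : ℕ} (l : Fin k × Bool) (v : R[X] × R[X]) :
    rep R ↑(cond l.2 (freeUnit R l.1) (freeUnit R l.1)⁻¹) v =
      PingPong.act (fun i : Fin k => (X : R[X]) ^ ((i : ℕ) + 1)) l v := by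
  obtain ⟨i, _ | _⟩ := l
  · simp only [cond_false, freeUnit, mul_inv_rev, Units.val_mul, PingPong.act]
    rw [map_mul, Module.End.mul_apply]
    simp only [oneAddUnit, Units.inv_mk, map_sub, map_one, LinearMap.sub_apply,
      Module.End.one_apply, rep_upper, rep_lower]
    refine Prod.ext ?_ ?_
    · simp
    · simp
      ring
  · simp only [cond_true, freeUnit, Units.val_mul, PingPong.act]
    rw [map_mul, Module.End.mul_apply]
    simp only [oneAddUnit, map_add, map_one, LinearMap.add_apply, Module.End.one_apply,
      rep_upper, rep_lower]
    refine Prod.ext ?_ ?_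
    · simp
      ring
    · simp

theorem rep_prod_freeUnit {k : ℕ} (L : List (Fin k × Bool)) (v : R[X] × R[X]) :
    rep R ↑(L.map fun l => cond l.2 (freeUnit R l.1) (freeUnit R l.1)⁻¹).prod v =
      L.foldr (PingPong.act fun i : Fin k => (X : R[X]) ^ ((i : ℕ) + 1)) v := by
  induction L with
  | nil => simp
  | cons l L ih =>
    rw [List.map_cons, List.prod_cons, Units.val_mul, map_mul, Module.End.mul_apply, ih,
      rep_freeUnit, List.foldr_cons]

end sqRel

/-- **Corollary.** Let `R` be an infinite field and `F = R⟨x, y⟩/(x², y²)`.  Then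
the unit group `U(F)` satisfies no group identity: for every nontrivial word `w` of
a free group there are units of `F` at which `w` does not evaluate to `1`. -/
theorem units_of_quotient_no_group_identity
    {R : Type*} [Field R] [Infinite R] (k : ℕ) (w : FreeGroup (Fin k)) (hw : w ≠ 1) :
    ∃ u : Fin k → (RingQuot (sqRel R))ˣ, (FreeGroup.lift u) w ≠ 1 := by
  refine ⟨fun i => sqRel.freeUnit R i, fun h => ?_⟩
  refine PingPong.foldr_act_ne (f := fun i : Fin k => (Polynomial.X : Polynomial R) ^ ((i : ℕ) + 1))
    (fun i => ?_) (fun i j hij => ?_) (FreeGroup.isReduced_toWord (x := w))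
    (by simpa [FreeGroup.toWord_eq_nil_iff] using hw) ?_
  · rw [Polynomial.degree_X_pow]
    exact_mod_cast Nat.succ_pos _
  · exact degree_X_pow_sub_X_pow_pos (by simpa [Fin.ext_iff] using hij)
  · rw [← FreeGroup.mk_toWord (x := w), FreeGroup.lift_mk] at h
    rw [← sqRel.rep_prod_freeUnit, h]
    simp
end
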